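/- arXiv:1710.08076 — 4 statements merged into one kernel-verified Lean document; each statement's English description precedes it below -/
import Mathlib

section
/- Let φ : ℝ³ → ℂ be integrable and let R be a linear isometric equivalence of ℝ³ (an orthogonal transformation). Define the projection of the rotated density P_R : ℝ² → ℂ by P_R(x,y) = ∫_ℝ φ(R⁻¹(x,y,z)) dz. Then for every (k_x, k_y) ∈ ℝ², the two-dimensional Fourier integral ∫_{ℝ²} e^{−2πi(k_x x + k_y y)} P_R(x,y) dx dy equals φ̂(R⁻¹(k_x, k_y, 0)); i.e., the 2D Fourier transform of a projection image is the restriction of the 3D Fourier transform of φ to the plane through the origin perpendicular to the viewing direction. -/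
open MeasureTheory Real Complex FourierTransform

theorem slice_aux : ∃ e : (ℝ × ℝ) × ℝ ≃ᵐ EuclideanSpace ℝ (Fin 3),
    MeasurePreserving e ∧
      ∀ v z, e (v, z) = (WithLp.equiv 2 (Fin 3 → ℝ)).symm ![v.1, v.2, z] := by
  have h1 := (volume_preserving_piFinTwo (fun _ => ℝ)).symm
  have h2 := h1.prod (MeasurePreserving.id (volume : Measure ℝ))
  have h3 : MeasurePreserving (MeasurableEquiv.prodComm : (Fin 2 → ℝ) × ℝ ≃ᵐ ℝ × (Fin 2 → ℝ)) :=
    Measure.measurePreserving_swap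
  have h4 := (volume_preserving_piFinSuccAbove (fun _ : Fin 3 => ℝ) (Fin.last 2)).symm
  have h5 := (EuclideanSpace.volume_preserving_symm_measurableEquiv_toLp (Fin 3)).symm
  refine ⟨((((MeasurableEquiv.piFinTwo (fun _ => ℝ)).symm.prodCongr
    (MeasurableEquiv.refl ℝ)).trans MeasurableEquiv.prodComm).trans
    (MeasurableEquiv.piFinSuccAbove (fun _ : Fin 3 => ℝ) (Fin.last 2)).symm).trans
    (MeasurableEquiv.toLp 2 (Fin 3 → ℝ)), ?_, ?_⟩
  · exact h5.comp (h4.comp (h3.comp h2))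
  · intro v z
    ext i
    fin_cases i <;> rfl

/-- Fourier-slice theorem: if `φ : ℝ³ → ℂ` is integrable, `R` is an orthogonal
transformation of `ℝ³`, and `P_R (x, y) = ∫ z, φ (R⁻¹ (x, y, z))` is the tomographic
projection of the rotated density, then the 2D Fourier integral of `P_R` at `(k_x, k_y)`
equals `φ̂ (R⁻¹ (k_x, k_y, 0))`: the 2D Fourier transform of a projection image is the
restriction of the 3D Fourier transform of `φ` to the plane through the origin
perpendicular to the viewing direction. -/
theorem stmt_2 (φ : EuclideanSpace ℝ (Fin 3) → ℂ) (hφ : Integrable φ)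
    (R : EuclideanSpace ℝ (Fin 3) ≃ₗᵢ[ℝ] EuclideanSpace ℝ (Fin 3))
    (P : ℝ → ℝ → ℂ)
    (hP : ∀ x y : ℝ,
      P x y = ∫ z : ℝ, φ (R.symm ((WithLp.equiv 2 (Fin 3 → ℝ)).symm ![x, y, z])))
    (kx ky : ℝ) :
    (∫ v : ℝ × ℝ, Complex.exp (-2 * π * Complex.I * (kx * v.1 + ky * v.2)) * P v.1 v.2)
      = 𝓕 φ (R.symm ((WithLp.equiv 2 (Fin 3 → ℝ)).symm ![kx, ky, 0])) := by
  obtain ⟨e, he, hev⟩ := slice_aux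
  rw [← Real.fourier_comp_linearIsometry, Real.fourier_eq', ← he.integral_comp']
  have hI : Integrable (φ ∘ R.symm) := (R.symm.measurePreserving.integrable_comp_emb
    R.symm.toMeasurableEquiv.measurableEmbedding).2 hφ
  have hc := ((Real.fourierIntegral_convergent_iff (μ := volume)
    ((WithLp.equiv 2 (Fin 3 → ℝ)).symm ![kx, ky, 0])).2 hI)
  have hc' := (he.integrable_comp_emb e.measurableEmbedding).2 hc
  have key : ∀ (v : ℝ × ℝ) (z : ℝ),
      inner ℝ (e (v, z)) ((WithLp.equiv 2 (Fin 3 → ℝ)).symm ![kx, ky, 0])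
        = kx * v.1 + ky * v.2 := by
    intro v z
    rw [hev]
    simp [PiLp.inner_apply, Fin.sum_univ_three]
  symm
  rw [Measure.volume_eq_prod (ℝ × ℝ) ℝ, integral_prod]
  · refine integral_congr_ae (Filter.Eventually.of_forall fun v => ?_)
    simp only [key]
    simp only [hP, Function.comp_apply, hev, smul_eq_mul]
    rw [integral_const_mul]
    congr 2
    push_cast
    ring
  · refine hc'.congr (Filter.Eventually.of_forall fun v => ?_)
    simp only [Function.comp_apply, Circle.smul_def, Real.fourierChar_apply]
    congr 2
    push_cast
    ring
end

section
/- Let M be a real n × n matrix. Then there exists a real n × n orthogonal matrix O such that Oᵀ M is positive semidefinite, and this O maximizes the trace against M over the orthogonal group: for every real n × n orthogonal matrix Q, trace(Qᵀ M) ≤ trace(Oᵀ M). -/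
open Matrix

lemma svd_aux (n : ℕ) (M : Matrix (Fin n) (Fin n) ℝ) :
    ∃ (U V : Matrix (Fin n) (Fin n) ℝ) (s : Fin n → ℝ), (∀ i, 0 ≤ s i) ∧
      Uᵀ * U = 1 ∧ Vᵀ * V = 1 ∧ M = U * diagonal s * Vᵀ := by
  have hS : (Mᵀ * M).PosSemidef := by
    simpa [conjTranspose_eq_transpose_of_trivial] using posSemidef_conjTranspose_mul_self M
  have hH := hS.isHermitian
  let V : Matrix (Fin n) (Fin n) ℝ := (hH.eigenvectorUnitary : Matrix (Fin n) (Fin n) ℝ)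
  let d := hH.eigenvalues
  have hd : ∀ i, 0 ≤ d i := hS.eigenvalues_nonneg
  have hV : Vᵀ * V = 1 := by
    have := (Unitary.mem_iff.1 hH.eigenvectorUnitary.2).1
    simpa [star_eq_conjTranspose, conjTranspose_eq_transpose_of_trivial] using this
  have hV' : V * Vᵀ = 1 := mul_eq_one_comm.1 hV
  have hsp : Mᵀ * M = V * diagonal d * Vᵀ := by
    have := hH.spectral_theorem
    rw [Unitary.conjStarAlgAut_apply] at this
    simpa [star_eq_conjTranspose, conjTranspose_eq_transpose_of_trivial, V, d,
      Function.comp_def] using this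
  have hN : (M * V)ᵀ * (M * V) = diagonal d := by
    calc (M * V)ᵀ * (M * V) = Vᵀ * (Mᵀ * M) * V := by
          rw [transpose_mul]; simp only [Matrix.mul_assoc]
      _ = (Vᵀ * V) * diagonal d * (Vᵀ * V) := by
          rw [hsp]; simp only [Matrix.mul_assoc]
      _ = _ := by rw [hV]; simp
  have hNe : ∀ i j, ∑ k, (M * V) k i * (M * V) k j = if i = j then d i else 0 := by
    intro i j
    have := congrFun (congrFun hN i) j
    rw [diagonal_apply, mul_apply] at this
    simpa only [transpose_apply] using this
  let v : Fin n → EuclideanSpace ℝ (Fin n) :=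
    fun i => WithLp.toLp 2 (fun k => (M * V) k i / √(d i))
  have hv : Orthonormal ℝ (Set.domRestrict {i | d i ≠ 0} v) := by
    rw [orthonormal_iff_ite]
    rintro ⟨i, hi⟩ ⟨j, hj⟩
    have h1 : inner ℝ (v i) (v j) = (∑ k, (M * V) k i * (M * V) k j) / (√(d i) * √(d j)) := by
      rw [Finset.sum_div]
      simp only [PiLp.inner_apply, v]
      refine Finset.sum_congr rfl fun k _ => ?_
      simp only [RCLike.inner_apply, conj_trivial]
      ring
    simp only [Set.domRestrict_apply, Subtype.mk.injEq]
    rw [h1, hNe]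
    split_ifs with h
    · subst h
      rw [Real.mul_self_sqrt (hd i)]
      exact div_self hi
    · simp
  obtain ⟨b, hb⟩ := hv.exists_orthonormalBasis_extension_of_card_eq (by simp)
  let U : Matrix (Fin n) (Fin n) ℝ := of fun k i => b i k
  have hU : Uᵀ * U = 1 := by
    ext i j
    have := orthonormal_iff_ite.1 b.orthonormal i j
    rw [mul_apply, one_apply, ← this, PiLp.inner_apply]
    refine Finset.sum_congr rfl fun k _ => ?_
    simp [U, mul_comm]
  refine ⟨U, V, fun i => √(d i), fun i => Real.sqrt_nonneg _, hU, hV, ?_⟩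
  have hMV : M * V = U * diagonal fun i => √(d i) := by
    ext k i
    rw [mul_diagonal]
    by_cases h : d i = 0
    · have h0 := hNe i i
      rw [if_pos rfl, h, Finset.sum_eq_zero_iff_of_nonneg (fun _ _ => mul_self_nonneg _)] at h0
      have := mul_self_eq_zero.1 (h0 k (Finset.mem_univ _))
      rw [this, h]; simp
    · have h2 : √(d i) ≠ 0 := (Real.sqrt_ne_zero (hd i)).2 h
      have : U k i = (M * V) k i / √(d i) := by
        simp only [U, of_apply]; rw [hb i h]
      rw [this, div_mul_cancel₀ _ h2]
  rw [← hMV, Matrix.mul_assoc, hV', Matrix.mul_one]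

/-- For every real `n × n` matrix `M` there exists a real `n × n` orthogonal matrix `O`
such that `Oᵀ * M` is positive semidefinite, and this `O` maximizes `trace (Qᵀ * M)`
over all orthogonal matrices `Q`. -/
theorem stmt_6 (n : ℕ) (M : Matrix (Fin n) (Fin n) ℝ) :
    ∃ O : Matrix (Fin n) (Fin n) ℝ, O * Oᵀ = 1 ∧ Oᵀ * O = 1 ∧
      (Oᵀ * M).PosSemidef ∧
      ∀ Q : Matrix (Fin n) (Fin n) ℝ, Q * Qᵀ = 1 → Qᵀ * Q = 1 →
        (Qᵀ * M).trace ≤ (Oᵀ * M).trace := by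
  obtain ⟨U, V, s, hs, hU, hV, rfl⟩ := svd_aux n M
  have hV' : V * Vᵀ = 1 := mul_eq_one_comm.1 hV
  have hU' : U * Uᵀ = 1 := mul_eq_one_comm.1 hU
  have hO : (U * Vᵀ)ᵀ * (U * Vᵀ) = 1 := by
    rw [transpose_mul, transpose_transpose, Matrix.mul_assoc, ← Matrix.mul_assoc Uᵀ, hU,
      Matrix.one_mul, hV']
  have hP : (U * Vᵀ)ᵀ * (U * diagonal s * Vᵀ) = V * diagonal s * Vᵀ := by
    rw [transpose_mul, transpose_transpose, Matrix.mul_assoc, Matrix.mul_assoc U,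
      ← Matrix.mul_assoc Uᵀ, hU, Matrix.one_mul, Matrix.mul_assoc]
  refine ⟨U * Vᵀ, mul_eq_one_comm.1 hO, hO, ?_, ?_⟩
  · rw [hP]
    have := (PosSemidef.diagonal (d := s) hs).mul_mul_conjTranspose_same V
    rwa [conjTranspose_eq_transpose_of_trivial] at this
  · intro Q hQ hQ'
    rw [hP, trace_mul_comm (V * diagonal s), ← Matrix.mul_assoc Vᵀ V, hV, Matrix.one_mul]
    have h1 : (Qᵀ * (U * diagonal s * Vᵀ)).trace = ((Vᵀ * Qᵀ * U) * diagonal s).trace := by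
      rw [← Matrix.mul_assoc, trace_mul_comm]
      simp only [Matrix.mul_assoc]
    have hW : (Vᵀ * Qᵀ * U)ᵀ * (Vᵀ * Qᵀ * U) = 1 := by
      calc (Vᵀ * Qᵀ * U)ᵀ * (Vᵀ * Qᵀ * U) = Uᵀ * (Q * ((V * Vᵀ) * Qᵀ)) * U := by
            simp only [transpose_mul, transpose_transpose, Matrix.mul_assoc]
        _ = 1 := by rw [hV', Matrix.one_mul, hQ, Matrix.mul_one, hU]
    rw [h1]
    generalize Vᵀ * Qᵀ * U = W at hW
    simp only [trace, diag_apply, mul_diagonal, diagonal_apply_eq]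
    refine Finset.sum_le_sum fun i _ => ?_
    have h2 := congrFun (congrFun hW i) i
    rw [mul_apply, one_apply_eq] at h2
    have h3 : W i i * W i i ≤ ∑ k, Wᵀ i k * W k i :=
      Finset.single_le_sum (f := fun k => Wᵀ i k * W k i)
        (fun k _ => mul_self_nonneg (W k i)) (Finset.mem_univ i)
    have h4 : W i i ≤ 1 := by nlinarith
    nlinarith [hs i]
end

section
/- Let M be a real n × n matrix and let Q be any real n × n orthogonal matrix. Then trace(Qᵀ M) ≤ trace((Mᵀ M)^{1/2}), where (Mᵀ M)^{1/2} is the positive semidefinite square root of the positive semidefinite matrix Mᵀ M; i.e., the maximum of trace(Qᵀ M) over orthogonal Q is bounded by the sum of the singular values of M. -/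
open Matrix

/-- For any real `n × n` matrix `M` and any orthogonal `n × n` matrix `Q`,
`trace (Qᵀ * M) ≤ trace ((Mᵀ * M)^{1/2})`, where `(Mᵀ * M)^{1/2}` is the (unique)
positive semidefinite square root `S` of the positive semidefinite matrix `Mᵀ * M`. -/
theorem stmt_7 (n : ℕ) (M Q : Matrix (Fin n) (Fin n) ℝ)
    (hQ : Q * Qᵀ = 1) (hQ' : Qᵀ * Q = 1)
    (S : Matrix (Fin n) (Fin n) ℝ) (hS : S.PosSemidef) (hSsq : S * S = Mᵀ * M) :
    (Qᵀ * M).trace ≤ S.trace := by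
  have hH := hS.isHermitian
  have hsp := hH.spectral_theorem
  set U : Matrix (Fin n) (Fin n) ℝ := (hH.eigenvectorUnitary : Matrix (Fin n) (Fin n) ℝ) with hU
  have hU1 : Uᵀ * U = 1 := by
    have h := Unitary.coe_star_mul_self hH.eigenvectorUnitary
    rw [star_eq_conjTranspose, conjTranspose_eq_transpose_of_trivial] at h
    exact h
  have hU2 : U * Uᵀ = 1 := mul_eq_one_comm.mp hU1
  have hd := hS.eigenvalues_nonneg
  have hSd : S = U * diagonal hH.eigenvalues * Uᵀ := by
    rw [Unitary.conjStarAlgAut_apply] at hsp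
    rw [star_eq_conjTranspose, conjTranspose_eq_transpose_of_trivial] at hsp
    exact hsp
  generalize hH.eigenvalues = d at hd hSd
  clear hsp
  clear_value U
  have hA : (Q * U)ᵀ * (Q * U) = 1 := by
    rw [transpose_mul, Matrix.mul_assoc, ← Matrix.mul_assoc Qᵀ, hQ', Matrix.one_mul, hU1]
  have hD : Uᵀ * S * U = diagonal d := by
    rw [hSd]
    calc _ = (Uᵀ * U) * diagonal d * (Uᵀ * U) := by simp only [Matrix.mul_assoc]
      _ = _ := by simp [hU1]
  have hB : (M * U)ᵀ * (M * U) = diagonal d * diagonal d := by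
    calc _ = Uᵀ * (Mᵀ * M) * U := by simp only [transpose_mul, Matrix.mul_assoc]
      _ = Uᵀ * (S * 1 * S) * U := by rw [Matrix.mul_one, hSsq]
      _ = (Uᵀ * S * U) * (Uᵀ * S * U) := by rw [← hU2]; simp only [Matrix.mul_assoc]
      _ = _ := by rw [hD]
  have hT : (Qᵀ * M).trace = ((Q * U)ᵀ * (M * U)).trace := by
    calc _ = (Qᵀ * M * (U * Uᵀ)).trace := by rw [hU2, Matrix.mul_one]
      _ = (Uᵀ * (Qᵀ * M * U)).trace := by rw [← Matrix.mul_assoc, trace_mul_comm]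
      _ = _ := by simp only [transpose_mul, Matrix.mul_assoc]
  have hTS : S.trace = (diagonal d).trace := by
    rw [hSd, trace_mul_comm, ← Matrix.mul_assoc, hU1, Matrix.one_mul]
  rw [hT, hTS]
  generalize Q * U = A at hA
  generalize M * U = B at hB
  rw [diagonal_mul_diagonal] at hB
  unfold Matrix.trace
  refine Finset.sum_le_sum fun j _ => ?_
  have h1 := congrFun (congrFun hA j) j
  have h2 := congrFun (congrFun hB j) j
  simp only [mul_apply, transpose_apply, one_apply_eq, diagonal_apply_eq]
    at h1 h2
  simp only [diag_apply, mul_apply, transpose_apply, diagonal_apply_eq]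
  have hcs := Finset.sum_mul_sq_le_sq_mul_sq Finset.univ (fun i => A i j) (fun i => B i j)
  simp only [pow_two (A _ _), pow_two (B _ _)] at hcs
  rw [h1, h2, one_mul, ← pow_two] at hcs
  exact abs_le_of_sq_le_sq' hcs (hd j) |>.2
end

section
/- Let D and B be real m × n matrices, and let O be a real m × m orthogonal matrix such that Oᵀ (B Dᵀ) is positive semidefinite. Then O solves the orthogonal Procrustes problem: for every real m × m orthogonal matrix Q, ‖O D − B‖_F ≤ ‖Q D − B‖_F. -/
open Matrix

lemma procrustes_expand (m n : ℕ) (D B : Matrix (Fin m) (Fin n) ℝ)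
    (Q : Matrix (Fin m) (Fin m) ℝ) (hQ : Qᵀ * Q = 1) :
    ((Q * D - B)ᵀ * (Q * D - B)).trace
      = (Dᵀ * D).trace - 2 * (Qᵀ * (B * Dᵀ)).trace + (Bᵀ * B).trace := by
  have h1 : (Q * D)ᵀ * (Q * D) = Dᵀ * D := by
    rw [transpose_mul, Matrix.mul_assoc, ← Matrix.mul_assoc Qᵀ, hQ, Matrix.one_mul]
  have h2 : ((Q * D)ᵀ * B).trace = (Qᵀ * (B * Dᵀ)).trace := by
    rw [transpose_mul, Matrix.mul_assoc, trace_mul_comm, Matrix.mul_assoc]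
  have h3 : (Bᵀ * (Q * D)).trace = (Qᵀ * (B * Dᵀ)).trace := by
    rw [← h2, ← trace_transpose, transpose_mul, transpose_transpose]
  rw [transpose_sub, Matrix.sub_mul, Matrix.mul_sub, Matrix.mul_sub, h1]
  simp only [trace_sub, h2, h3]
  ring

lemma procrustes_trace (m : ℕ) (P W : Matrix (Fin m) (Fin m) ℝ) (hP : P.PosSemidef)
    (hW : Wᵀ * W = 1) : (W * P).trace ≤ P.trace := by
  have h := (hP.mul_mul_conjTranspose_same (1 - W)).trace_nonneg
  have hs : Pᵀ = P := by simpa using hP.isHermitian.eq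
  have e1 : (P * Wᵀ).trace = (W * P).trace := by
    rw [← trace_transpose, transpose_mul, transpose_transpose, hs]
  have e2 : (W * P * Wᵀ).trace = P.trace := by
    rw [trace_mul_comm, ← Matrix.mul_assoc, hW, Matrix.one_mul]
  rw [conjTranspose_eq_transpose_of_trivial, transpose_sub, transpose_one, Matrix.mul_sub,
    Matrix.sub_mul, Matrix.sub_mul, Matrix.one_mul, Matrix.mul_one, Matrix.sub_mul] at h
  simp only [trace_sub, Matrix.mul_one, e1, e2] at h
  linarith


/-- Orthogonal Procrustes: if `O` is an orthogonal `m × m` matrix such that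
`Oᵀ * (B * Dᵀ)` is positive semidefinite, then `O` minimizes the Frobenius norm
`‖Q * D - B‖_F = √(trace ((Q * D - B)ᵀ * (Q * D - B)))` over orthogonal `Q`. -/
theorem stmt_9 (m n : ℕ) (D B : Matrix (Fin m) (Fin n) ℝ)
    (O : Matrix (Fin m) (Fin m) ℝ) (hO : O * Oᵀ = 1) (hO' : Oᵀ * O = 1)
    (hpsd : (Oᵀ * (B * Dᵀ)).PosSemidef) :
    ∀ Q : Matrix (Fin m) (Fin m) ℝ, Q * Qᵀ = 1 → Qᵀ * Q = 1 →
      Real.sqrt ((O * D - B)ᵀ * (O * D - B)).trace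
        ≤ Real.sqrt ((Q * D - B)ᵀ * (Q * D - B)).trace := by
  intro Q hQ hQ'
  apply Real.sqrt_le_sqrt
  rw [procrustes_expand m n D B O hO', procrustes_expand m n D B Q hQ']
  have h := procrustes_trace m _ (Qᵀ * O) hpsd (by
    rw [transpose_mul, transpose_transpose, Matrix.mul_assoc, ← Matrix.mul_assoc Q, hQ,
      Matrix.one_mul, hO'])
  rw [Matrix.mul_assoc, ← Matrix.mul_assoc O, hO, Matrix.one_mul] at h
  linarith
end
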